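/- Assume the principle ω^ω-cohere holds. Suppose F : Set ℕ → Set ℕ induces an automorphism of P(ω)/fin, triv(F) is a proper dense ideal (ℕ ∉ triv(F), and every infinite subset of ℕ has an infinite subset in triv(F)), and ⟨a_n : n ∈ ℕ⟩ is a ⊆*-increasing sequence of members of triv(F) such that no a ∈ triv(F) satisfies a_n ⊆* a for all n. Then there exists a ⊆*-increasing sequence ⟨b_ξ : ξ < ω₁⟩ of subsets of ℕ, each having finite intersection with every a_n, such that b_{ξ+1} \ b_ξ ∉ triv(F) for every ξ < ω₁; consequently {b_{ξ+1} \ b_ξ : ξ < ω₁} is an uncountable almost disjoint family of infinite subsets of ℕ none of whose members is in triv(F), so triv(F) is not ccc over fin. -/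

import Mathlib

/-- `x =* y`: the symmetric difference of `x` and `y` is finite. -/
def EqStar (x y : Set ℕ) : Prop := ((x \ y) ∪ (y \ x)).Finite

/-- `F` induces an automorphism of `P(ω)/fin`. -/
def InducesAuto (F : Set ℕ → Set ℕ) : Prop :=
  (∀ x y : Set ℕ, EqStar x y → EqStar (F x) (F y)) ∧
  (∀ x y : Set ℕ, EqStar (F (x ∪ y)) (F x ∪ F y)) ∧
  (∀ x : Set ℕ, EqStar (F xᶜ) (F x)ᶜ) ∧
  (∀ x y : Set ℕ, EqStar (F x) (F y) → EqStar x y) ∧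
  (∀ y : Set ℕ, ∃ x : Set ℕ, EqStar (F x) y)

/-- `triv F`: the sets on which `F` is trivial. -/
def Triv (F : Set ℕ → Set ℕ) : Set (Set ℕ) :=
  {a | ∃ h : ℕ → ℕ, Set.InjOn h a ∧ ∀ x : Set ℕ, x ⊆ a → EqStar (F x) (h '' x)}

/-- `f^↓ = {(n,m) : m < f n}`. -/
def downSet (f : ℕ → ℕ) : Set (ℕ × ℕ) := {p | p.2 < f p.1}

/-- The principle ω^ω-cohere. -/
def OmegaCohere : Prop :=
  ∀ H : (ℕ → ℕ) → (ℕ × ℕ → ℕ),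
    (∀ f g : ℕ → ℕ, {p ∈ downSet f ∩ downSet g | H f p ≠ H g p}.Finite) →
    ∃ h : ℕ × ℕ → ℕ, ∀ f : ℕ → ℕ, {p ∈ downSet f | h p ≠ H f p}.Finite

/-- An almost disjoint family: infinite sets with pairwise finite intersections. -/
def AlmostDisjointFam (𝒜 : Set (Set ℕ)) : Prop :=
  (∀ a ∈ 𝒜, a.Infinite) ∧ ∀ a ∈ 𝒜, ∀ b ∈ 𝒜, a ≠ b → (a ∩ b).Finite

/-- An ideal `I` on `A ⊆ ℕ` is ccc over fin if every uncountable almost disjoint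
family of subsets of `A` has a member in `I`. -/
def CccOverFin (A : Set ℕ) (I : Set (Set ℕ)) : Prop :=
  ∀ 𝒜 : Set (Set ℕ), ¬𝒜.Countable → (∀ a ∈ 𝒜, a ⊆ A) → AlmostDisjointFam 𝒜 →
    ∃ a ∈ 𝒜, a ∈ I

open Filter in
theorem eqStar_iff {x y : Set ℕ} : EqStar x y ↔ ∀ᶠ k in cofinite, k ∈ x ↔ k ∈ y := by
  rw [EqStar, eventually_cofinite]
  congr! 1
  ext k
  simp only [Set.mem_union, Set.mem_sdiff, Set.mem_ofPred_eq]
  tauto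

theorem EqStar.symm {x y : Set ℕ} (h : EqStar x y) : EqStar y x := by
  rwa [EqStar, Set.union_comm]

theorem EqStar.trans {x y z : Set ℕ} (h : EqStar x y) (h' : EqStar y z) : EqStar x z := by
  rw [eqStar_iff] at *
  filter_upwards [h, h'] with k h h' using h.trans h'

theorem EqStar.union {x y x' y' : Set ℕ} (h : EqStar x y) (h' : EqStar x' y') :
    EqStar (x ∪ x') (y ∪ y') := by
  rw [eqStar_iff] at *
  filter_upwards [h, h'] with k h h' using or_congr h h'

theorem EqStar.finite_iff {x y : Set ℕ} (h : EqStar x y) : x.Finite ↔ y.Finite := by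
  rw [EqStar, Set.finite_union] at h
  exact ⟨fun hx ↦ (hx.union h.2).subset fun k hk ↦ by simp; tauto,
    fun hy ↦ (hy.union h.1).subset fun k hk ↦ by simp; tauto⟩

theorem EqStar.image {x y : Set ℕ} (h : EqStar x y) (f : ℕ → ℕ) : EqStar (f '' x) (f '' y) := by
  refine (Set.Finite.image f h).subset ?_
  rintro _ (⟨⟨j, hj, rfl⟩, hk⟩ | ⟨⟨j, hj, rfl⟩, hk⟩)
  · exact Set.mem_image_of_mem f (Or.inl ⟨hj, fun h' ↦ hk ⟨j, h', rfl⟩⟩)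
  · exact Set.mem_image_of_mem f (Or.inr ⟨hj, fun h' ↦ hk ⟨j, h', rfl⟩⟩)

namespace InducesAuto

theorem congr {F : Set ℕ → Set ℕ} (hF : InducesAuto F) {x y : Set ℕ} (h : EqStar x y) :
    EqStar (F x) (F y) := hF.1 x y h

theorem union {F : Set ℕ → Set ℕ} (hF : InducesAuto F) (x y : Set ℕ) :
    EqStar (F (x ∪ y)) (F x ∪ F y) := hF.2.1 x y

theorem exists_preimage {F : Set ℕ → Set ℕ} (hF : InducesAuto F) (y : Set ℕ) :
    ∃ x, EqStar (F x) y := hF.2.2.2.2 y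

theorem mono {F : Set ℕ → Set ℕ} (hF : InducesAuto F) {x y : Set ℕ} (h : (x \ y).Finite) :
    (F x \ F y).Finite := by
  have hxy : EqStar (x ∪ y) y := h.subset fun k hk ↦ by simp at hk ⊢; tauto
  refine ((hF.congr hxy).symm.trans (hF.union x y)).subset fun k hk ↦ ?_
  simp at hk ⊢; tauto

theorem mono_of_subset {F : Set ℕ → Set ℕ} (hF : InducesAuto F) {x y : Set ℕ} (h : x ⊆ y) :
    (F x \ F y).Finite :=
  hF.mono (by simp [Set.sdiff_eq_empty.2 h])

theorem inter_finite {F : Set ℕ → Set ℕ} (hF : InducesAuto F) {x y : Set ℕ}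
    (h : (x ∩ y).Finite) : (F x ∩ F y).Finite := by
  have h1 : (F x \ F yᶜ).Finite := hF.mono (by simpa [Set.sdiff_eq] using h)
  refine (h1.union (hF.2.2.1 y)).subset fun k hk ↦ ?_
  simp at hk ⊢; tauto

theorem finite_iff {F : Set ℕ → Set ℕ} (hF : InducesAuto F) {x : Set ℕ} :
    (F x).Finite ↔ x.Finite := by
  have h0 : (F ∅).Finite := by simpa using hF.inter_finite (x := ∅) (y := ∅) (by simp)
  constructor
  · intro h
    have : EqStar x ∅ := hF.2.2.2.1 x ∅ ((h.union h0).subset fun k hk ↦ by simp at hk ⊢; tauto)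
    simpa [EqStar] using this
  · intro h
    exact (hF.congr (x := x) (y := ∅) (by simpa [EqStar] using h)).finite_iff.2 h0

theorem diff_finite_of_diff_finite {F : Set ℕ → Set ℕ} (hF : InducesAuto F) {x y : Set ℕ}
    (h : (F x \ F y).Finite) : (x \ y).Finite := by
  rw [← hF.finite_iff]
  have h1 := hF.mono_of_subset (x := x \ y) (y := x) Set.sdiff_subset
  have h2 := hF.inter_finite (x := x \ y) (y := y) (by simp)
  refine ((h.union h1).union h2).subset fun k hk ↦ ?_
  simp; tauto

end InducesAuto

/-- `h` induces `F` modulo finite sets below `c`. -/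
def Induces (F : Set ℕ → Set ℕ) (h : ℕ → ℕ) (c : Set ℕ) : Prop :=
  ∀ x ⊆ c, EqStar (F x) (h '' x)

theorem exists_seq_of_forall_finset_exists_ne {α : Type*} (P : α → Prop) (R : α → α → Prop)
    (h : ∀ s : Finset α, (∀ x ∈ s, P x) → ∃ y, P y ∧ ∀ x ∈ s, R x y ∧ R y x) :
    ∃ f : ℕ → α, (∀ n, P (f n)) ∧ ∀ m n, m ≠ n → R (f m) (f n) := by
  obtain ⟨f, hP, hR⟩ := exists_seq_of_forall_finset_exists P (fun x y ↦ R x y ∧ R y x) h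
  refine ⟨f, hP, fun m n hmn ↦ ?_⟩
  rcases hmn.lt_or_gt with h | h
  exacts [(hR m n h).1, (hR n m h).2]

/-- Collisions of `h` that occur arbitrarily far out along `r` can be split into two disjoint
sets with the same image, meeting each level of `r` in a finite set. -/
theorem exists_disjoint_image_eq (h r : ℕ → ℕ) (c : Set ℕ)
    (hcol : ∀ n, ¬ Set.InjOn h {k ∈ c | n < r k}) :
    ∃ x ⊆ c, ∃ y ⊆ c, Disjoint x y ∧ x.Infinite ∧ h '' x = h '' y ∧
      (∀ n, {k ∈ x | r k ≤ n}.Finite) ∧ ∀ n, {k ∈ y | r k ≤ n}.Finite := by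
  obtain ⟨f, hP, hR⟩ := exists_seq_of_forall_finset_exists
    (fun p : ℕ × ℕ ↦ p.1 ∈ c ∧ p.2 ∈ c ∧ p.1 ≠ p.2 ∧ h p.1 = h p.2)
    (fun p q ↦ r p.1 < r q.1 ∧ r p.1 < r q.2 ∧ r p.2 < r q.1 ∧ r p.2 < r q.2) (by
      intro s _
      have := hcol (s.sup fun p ↦ max (r p.1) (r p.2))
      simp only [Set.InjOn, not_forall] at this
      obtain ⟨p, hp, q, hq, hpq, hne⟩ := this
      refine ⟨(p, q), ⟨hp.1, hq.1, hne, hpq⟩, fun z hz ↦ ?_⟩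
      have hz' : max (r z.1) (r z.2) ≤ _ := Finset.le_sup (f := fun p ↦ max (r p.1) (r p.2)) hz
      have h1 := hp.2
      have h2 := hq.2
      simp only
      omega)
  have hmono1 : StrictMono fun n ↦ r (f n).1 := fun m n hmn ↦ (hR m n hmn).1
  have hmono2 : StrictMono fun n ↦ r (f n).2 := fun m n hmn ↦ (hR m n hmn).2.2.2
  refine ⟨Set.range fun n ↦ (f n).1, ?_, Set.range fun n ↦ (f n).2, ?_, ?_, ?_, ?_, ?_, ?_⟩
  · rintro _ ⟨n, rfl⟩; exact (hP n).1
  · rintro _ ⟨n, rfl⟩; exact (hP n).2.1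
  · rw [Set.disjoint_left]
    rintro _ ⟨n, rfl⟩ ⟨m, hm⟩
    simp only at hm
    rcases lt_trichotomy m n with hmn | rfl | hmn
    · have := (hR m n hmn).2.2.1
      rw [hm] at this; omega
    · exact (hP m).2.2.1 hm.symm
    · have := (hR n m hmn).2.1
      rw [hm] at this; omega
  · exact Set.infinite_range_of_injective fun m n hmn ↦ hmono1.injective (congrArg r hmn)
  · simp only [← Set.range_comp]
    congr 1
    funext n
    exact (hP n).2.2.2
  · intro n
    refine ((Set.finite_Iic n).image fun n ↦ (f n).1).subset ?_
    rintro _ ⟨⟨m, rfl⟩, hm⟩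
    exact ⟨m, (hmono1.le_apply).trans hm, rfl⟩
  · intro n
    refine ((Set.finite_Iic n).image fun n ↦ (f n).2).subset ?_
    rintro _ ⟨⟨m, rfl⟩, hm⟩
    exact ⟨m, (hmono2.le_apply).trans hm, rfl⟩

theorem finite_inter_preimage {h : ℕ → ℕ} {T A : Set ℕ} (hT : Set.InjOn h T) (hA : A.Finite) :
    (T ∩ h ⁻¹' A).Finite :=
  Set.Finite.of_finite_image (hA.subset (by rintro _ ⟨k, hk, rfl⟩; exact hk.2))
    (hT.mono Set.inter_subset_left)

namespace Induces

theorem mono {F : Set ℕ → Set ℕ} {h : ℕ → ℕ} {c d : Set ℕ} (hc : Induces F h c) (hdc : d ⊆ c) :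
    Induces F h d := fun x hx ↦ hc x (hx.trans hdc)

theorem of_diff_finite {F : Set ℕ → Set ℕ} (hF : InducesAuto F) {h : ℕ → ℕ} {c d : Set ℕ}
    (hc : Induces F h c) (hdc : (d \ c).Finite) : Induces F h d := by
  intro x hx
  have h1 : EqStar x (x ∩ c) := hdc.subset fun k hk ↦ by
    have := @hx k
    simp at hk ⊢; tauto
  exact (hF.congr h1).trans ((hc _ Set.inter_subset_right).trans (h1.symm.image h))

theorem congr {F : Set ℕ → Set ℕ} {h g : ℕ → ℕ} {c : Set ℕ} (hc : Induces F h c)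
    (hgh : {k ∈ c | g k ≠ h k}.Finite) : Induces F g c := by
  intro x hx
  refine (hc x hx).trans (((hgh.image h).union (hgh.image g)).subset ?_)
  rintro k (⟨⟨j, hj, rfl⟩, hk⟩ | ⟨⟨j, hj, rfl⟩, hk⟩)
  · exact Or.inl ⟨j, ⟨hx hj, fun e ↦ hk ⟨j, hj, e⟩⟩, rfl⟩
  · exact Or.inr ⟨j, ⟨hx hj, fun e ↦ hk ⟨j, hj, e.symm⟩⟩, rfl⟩

theorem exists_injOn {F : Set ℕ → Set ℕ} (hF : InducesAuto F) {h : ℕ → ℕ} {c : Set ℕ}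
    (r : ℕ → ℕ) (hc : ∀ x ⊆ c, (∀ n, {k ∈ x | r k ≤ n}.Finite) → EqStar (F x) (h '' x)) :
    ∃ n : ℕ, Set.InjOn h {k ∈ c | n < r k} := by
  by_contra! hcon
  obtain ⟨x, hx, y, hy, hd, hinf, he, hxf, hyf⟩ := exists_disjoint_image_eq h r c hcon
  have hxy : EqStar (F x) (F y) := (hc x hx hxf).trans (he ▸ (hc y hy hyf).symm)
  refine hinf ((hF.2.2.2.1 x y hxy).subset fun k hk ↦ Or.inl ⟨hk, ?_⟩)
  exact Set.disjoint_left.1 hd hk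

theorem exists_finite_injOn {F : Set ℕ → Set ℕ} (hF : InducesAuto F) {h : ℕ → ℕ} {c : Set ℕ}
    (hc : Induces F h c) : ∃ s : Set ℕ, s.Finite ∧ Set.InjOn h (c \ s) := by
  obtain ⟨n, hn⟩ := exists_injOn hF id (fun x hx _ ↦ hc x hx)
  exact ⟨Set.Iic n, Set.finite_Iic n, hn.mono fun k hk ↦ by simpa using hk⟩

theorem finite_ne {F : Set ℕ → Set ℕ} (hF : InducesAuto F) {h g : ℕ → ℕ} {c : Set ℕ}
    (hc : Induces F h c) (gc : Induces F g c) : {k ∈ c | h k ≠ g k}.Finite := by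
  obtain ⟨s, hs, hsi⟩ := hc.exists_finite_injOn hF
  obtain ⟨t, ht, hti⟩ := gc.exists_finite_injOn hF
  by_contra hinf
  set T := {k ∈ c | h k ≠ g k} \ (s ∪ t) with hT
  have hTinf : T.Infinite := Set.Infinite.sdiff hinf (hs.union ht)
  have hTs : Set.InjOn h T := hsi.mono fun k hk ↦ by simp [hT] at hk ⊢; tauto
  have hTt : Set.InjOn g T := hti.mono fun k hk ↦ by simp [hT] at hk ⊢; tauto
  obtain ⟨f, hP, hR⟩ := exists_seq_of_forall_finset_exists_ne (· ∈ T) (fun p q ↦ p ≠ q ∧ h p ≠ g q) (by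
    intro u hu
    have h1 : (T ∩ g ⁻¹' (h '' u)).Finite :=
      finite_inter_preimage hTt (u.finite_toSet.image h)
    have h2 : (T ∩ h ⁻¹' (g '' u)).Finite :=
      finite_inter_preimage hTs (u.finite_toSet.image g)
    obtain ⟨k, hk, hk'⟩ := (hTinf.sdiff ((h1.union h2).union u.finite_toSet)).nonempty
    refine ⟨k, hk, fun x hx ↦ ?_⟩
    simp only [Set.mem_union, not_or, Set.mem_inter_iff, not_and] at hk'
    have hxk : x ≠ k := fun e ↦ hk'.2 (by simpa [e] using hx)
    refine ⟨⟨hxk, fun e ↦ hk'.1.1 hk ⟨x, hx, e⟩⟩, hxk.symm, fun e ↦ hk'.1.2 hk ⟨x, hx, e.symm⟩⟩)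
  have hEc : Set.range f ⊆ c := by rintro _ ⟨n, rfl⟩; exact (hP n).1.1
  have hinfE : (Set.range f).Infinite :=
    Set.infinite_range_of_injective fun m n hmn ↦ by_contra fun hne ↦ (hR m n hne).1 hmn
  refine hinfE (hF.finite_iff.1 ?_)
  refine (Set.Finite.union (hc _ hEc) (gc _ hEc)).subset fun k hk ↦ ?_
  by_cases hk' : k ∈ h '' Set.range f
  · refine Or.inr (Or.inl ⟨hk, ?_⟩)
    obtain ⟨_, ⟨m, rfl⟩, rfl⟩ := hk'
    rintro ⟨_, ⟨n, rfl⟩, hn⟩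
    by_cases hmn : m = n
    · subst hmn
      exact (hP m).1.2 hn.symm
    · exact (hR m n hmn).2 hn.symm
  · exact Or.inl (Or.inl ⟨hk, hk'⟩)

end Induces

/-- `c` meets each sublevel set of `r` in a finite set. -/
def FiniteLevels (r : ℕ → ℕ) (c : Set ℕ) : Prop :=
  ∀ n, {k ∈ c | r k ≤ n}.Finite

theorem Induces.piecewise {F : Set ℕ → Set ℕ} (hF : InducesAuto F) {h g : ℕ → ℕ} {c d : Set ℕ}
    (hc : Induces F h c) (gd : Induces F g d) : ∃ f, Induces F f (c ∪ d) := by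
  classical
  refine ⟨c.piecewise h g, fun x hx ↦ ?_⟩
  have h1 := hc (x ∩ c) Set.inter_subset_right
  have h2 := gd (x \ c) fun k hk ↦ (hx hk.1).resolve_left hk.2
  have h3 := (hF.union (x ∩ c) (x \ c)).trans (h1.union h2)
  rw [Set.inter_union_sdiff] at h3
  convert h3 using 1
  nth_rewrite 1 [← Set.inter_union_sdiff x c]
  rw [Set.image_union]
  congr 1
  · exact Set.image_congr fun k hk ↦ Set.piecewise_eq_of_mem _ _ _ hk.2
  · exact Set.image_congr fun k hk ↦ Set.piecewise_eq_of_notMem _ _ _ hk.2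

/-- If `h` fails to induce `F` at `x`, then it does so badly on an infinite subset of `x`. -/
theorem exists_infinite_inter_image_finite {F : Set ℕ → Set ℕ} (hF : InducesAuto F) {h : ℕ → ℕ}
    {x : Set ℕ} (hx : ¬ EqStar (F x) (h '' x)) :
    ∃ E ⊆ x, E.Infinite ∧ (F E ∩ h '' E).Finite := by
  rw [EqStar, Set.finite_union, not_and_or] at hx
  rcases hx with hx | hx
  · obtain ⟨z, hz⟩ := hF.exists_preimage (F x \ h '' x)
    have hzinf : z.Infinite := fun hfin ↦ hx (hz.finite_iff.1 (hF.finite_iff.2 hfin))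
    have hzx : (z \ x).Finite := hF.diff_finite_of_diff_finite (hz.subset fun k hk ↦ by
      simp at hk ⊢; tauto)
    refine ⟨z ∩ x, Set.inter_subset_right, ?_, ?_⟩
    · intro hfin
      exact hzinf ((hfin.union hzx).subset fun k hk ↦ by simp; tauto)
    · have h1 : (F (z ∩ x) \ F z).Finite := hF.mono_of_subset Set.inter_subset_left
      refine (Set.Finite.union h1 hz).subset fun k hk ↦ ?_
      have h2 : k ∈ h '' x := Set.image_mono Set.inter_subset_right hk.2
      have h3 := hk.1
      simp only [Set.mem_union, Set.mem_sdiff]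
      tauto
  · refine ⟨{k ∈ x | h k ∉ F x}, fun k hk ↦ hk.1, fun hfin ↦ hx ?_, ?_⟩
    · refine (hfin.image h).subset ?_
      rintro _ ⟨⟨k, hk, rfl⟩, hk'⟩
      exact ⟨k, ⟨hk, hk'⟩, rfl⟩
    · have h1 : (F {k ∈ x | h k ∉ F x} \ F x).Finite :=
        hF.mono_of_subset fun k hk ↦ hk.1
      refine h1.subset ?_
      rintro _ ⟨h2, k, hk, rfl⟩
      exact ⟨h2, hk.2⟩

theorem exists_infinite_free {N : Set ℕ} (hN : N.Infinite) (κ : ℕ → ℕ)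
    (hκ : ∀ n ∈ N, κ n ≠ n) : ∃ N' ⊆ N, N'.Infinite ∧ ∀ n ∈ N', κ n ∉ N' := by
  by_cases hfib : ∃ v, (N ∩ κ ⁻¹' {v}).Infinite
  · obtain ⟨v, hv⟩ := hfib
    refine ⟨N ∩ κ ⁻¹' {v}, Set.inter_subset_left, hv, fun n hn hn' ↦ ?_⟩
    have h1 : κ n = v := hn.2
    have h2 : κ (κ n) = v := hn'.2
    exact hκ _ hn'.1 (h2.trans h1.symm)
  · push Not at hfib
    obtain ⟨f, hP, hR⟩ := exists_seq_of_forall_finset_exists_ne (· ∈ N) (fun m n ↦ m ≠ n ∧ κ m ≠ n) (by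
      intro s _
      have h1 : (⋃ v ∈ s, N ∩ κ ⁻¹' {v}).Finite :=
        s.finite_toSet.biUnion fun v _ ↦ hfib v
      obtain ⟨m, hm, hm'⟩ :=
        (hN.sdiff ((h1.union s.finite_toSet).union (s.finite_toSet.image κ))).nonempty
      simp only [Set.mem_union, not_or, Set.mem_iUnion, not_exists] at hm'
      have hms : ∀ v ∈ s, v ≠ m := fun v hv e ↦ hm'.1.2 (by simpa [e] using hv)
      exact ⟨m, hm, fun v hv ↦ ⟨⟨hms v hv, fun e ↦ hm'.2 ⟨v, hv, e⟩⟩, (hms v hv).symm,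
        fun e ↦ hm'.1.1 v hv ⟨hm, e⟩⟩⟩)
    refine ⟨Set.range f, ?_, ?_, ?_⟩
    · rintro _ ⟨n, rfl⟩; exact hP n
    · exact Set.infinite_range_of_injective fun m n hmn ↦ by_contra fun hne ↦ (hR m n hne).1 hmn
    · rintro _ ⟨n, rfl⟩ ⟨m, hm⟩
      by_cases hnm : n = m
      · subst hnm; exact hκ _ (hP n) hm.symm
      · exact (hR n m hnm).2 hm.symm

theorem OmegaCohere.exists_induces (hω : OmegaCohere) {F : Set ℕ → Set ℕ} (hF : InducesAuto F)
    {r : ℕ → ℕ} {X : Set ℕ} (hX : ∀ c ⊆ X, FiniteLevels r c → ∃ g, Induces F g c) :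
    ∃ h, ∀ c ⊆ X, FiniteLevels r c → Induces F h c := by
  classical
  have hfl (f : ℕ → ℕ) : FiniteLevels r {k ∈ X | k < f (r k)} := fun n ↦ by
    refine ((Set.finite_Iic n).biUnion fun i _ ↦ Set.finite_Iio (f i)).subset fun k hk ↦ ?_
    simp only [Set.mem_iUnion]
    exact ⟨r k, hk.2, hk.1.2⟩
  choose g hg using fun f ↦ hX {k ∈ X | k < f (r k)} (fun k hk ↦ hk.1) (hfl f)
  obtain ⟨h, hh⟩ := hω (fun f p ↦ if p.2 ∈ X ∧ r p.2 = p.1 then g f p.2 else 0) (by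
    intro f f'
    have h1 := ((hg f).mono (d := {k ∈ X | k < f (r k) ∧ k < f' (r k)})
      (fun k hk ↦ ⟨hk.1, hk.2.1⟩)).finite_ne hF ((hg f').mono fun k hk ↦ ⟨hk.1, hk.2.2⟩)
    refine (h1.image fun k ↦ (r k, k)).subset ?_
    rintro ⟨n, k⟩ ⟨⟨hk, hk'⟩, hne⟩
    simp only [downSet, Set.mem_ofPred_eq] at hk hk'
    by_cases hX : k ∈ X ∧ r k = n
    · obtain ⟨hX, rfl⟩ := hX
      exact ⟨k, ⟨⟨hX, hk, hk'⟩, by simpa [hX] using hne⟩, rfl⟩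
    · simp [hX] at hne)
  refine ⟨fun k ↦ h (r k, k), fun c hc hcl ↦ ?_⟩
  choose f hf using fun n ↦ (hcl n).bddAbove
  have hcf : c ⊆ {k ∈ X | k < f (r k) + 1} := fun k hk ↦
    ⟨hc hk, Nat.lt_succ_of_le (hf (r k) ⟨hk, le_rfl⟩)⟩
  refine ((hg fun n ↦ f n + 1).congr ?_).mono hcf
  refine Set.Finite.of_finite_image ((hh fun n ↦ f n + 1).subset ?_)
    (f := fun k ↦ (r k, k)) fun k _ l _ hkl ↦ (Prod.ext_iff.1 hkl).2
  rintro _ ⟨k, ⟨⟨hkX, hk⟩, hne⟩, rfl⟩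
  exact ⟨hk, by simpa [hkX] using hne⟩

theorem finite_image_notMem {F : Set ℕ → Set ℕ} (hF : InducesAuto F) {h r : ℕ → ℕ} {x : Set ℕ}
    (hind : ∀ c ⊆ x, FiniteLevels r c → Induces F h c) (hinj : Set.InjOn h x) :
    (r '' {k ∈ x | h k ∉ F x}).Finite := by
  by_contra hinf
  obtain ⟨c, hc, hbij⟩ := Set.SurjOn.exists_bijOn_subset
    (Set.surjOn_image r {k ∈ x | h k ∉ F x})
  have hcx : c ⊆ x := fun k hk ↦ (hc hk).1
  have hcinf : c.Infinite := fun hfin ↦ hinf (hbij.image_eq ▸ hfin.image r)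
  have hcl : FiniteLevels r c := fun n ↦
    (finite_inter_preimage hbij.injOn (Set.finite_Iic n)).subset fun k hk ↦ hk
  refine hcinf.image (hinj.mono hcx) ?_
  have h1 : (F c \ F x).Finite := hF.mono_of_subset hcx
  refine (Set.Finite.union h1 (hind c hcx hcl c subset_rfl)).subset ?_
  rintro _ ⟨k, hk, rfl⟩
  have h2 : h k ∉ F x := (hc hk).2
  have h3 : h k ∈ h '' c := ⟨k, hk, rfl⟩
  simp only [Set.mem_union, Set.mem_sdiff]
  tauto

theorem exists_ne_infinite_inter {F : Set ℕ → Set ℕ} (hF : InducesAuto F) {h r : ℕ → ℕ}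
    {N x : Set ℕ} {E : ℕ → Set ℕ} (hx : x = ⋃ n ∈ N, E n) (hE : ∀ n ∈ N, ∀ k ∈ E n, r k = n)
    (hind : ∀ c ⊆ x, FiniteLevels r c → Induces F h c) (hinj : Set.InjOn h x)
    {n : ℕ} (hn : n ∈ N) (hEinf : (E n).Infinite) (hEfin : (F (E n) ∩ h '' E n).Finite)
    (hsub : h '' E n ⊆ F x) : ∃ m ∈ N, m ≠ n ∧ (F (E m) ∩ h '' E n).Infinite := by
  by_contra! hcon
  have hEx (m) (hm : m ∈ N) : E m ⊆ x := hx ▸ Set.subset_biUnion_of_mem hm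
  obtain ⟨W, hW⟩ := hF.exists_preimage (h '' E n)
  have hWinf : W.Infinite := fun hfin ↦
    hEinf.image (hinj.mono (hEx n hn)) (hW.finite_iff.1 (hF.finite_iff.2 hfin))
  have hWE : ∀ m ∈ N, (W ∩ E m).Finite := by
    intro m hm
    have hfin : (F (E m) ∩ h '' E n).Finite := by
      by_cases hmn : m = n
      · exact hmn ▸ hEfin
      · exact hcon m hm hmn
    rw [← hF.finite_iff]
    have h1 : (F (W ∩ E m) \ F W).Finite := hF.mono_of_subset Set.inter_subset_left
    have h2 : (F (W ∩ E m) \ F (E m)).Finite := hF.mono_of_subset Set.inter_subset_right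
    refine (((h1.union h2).union hW).union hfin).subset fun k hk ↦ ?_
    simp only [Set.mem_union, Set.mem_sdiff, Set.mem_inter_iff]
    tauto
  have hWx : (W \ x).Finite := hF.diff_finite_of_diff_finite (hW.subset fun k hk ↦
    Or.inl ⟨hk.1, fun h' ↦ hk.2 (hsub h')⟩)
  set c := (W ∩ x) \ E n with hc
  have hcx : c ⊆ x := fun k hk ↦ hk.1.2
  have hcinf : c.Infinite := fun hfin ↦
    hWinf (((hfin.union (hWE n hn)).union hWx).subset fun k hk ↦ by simp [hc]; tauto)
  have hcl : FiniteLevels r c := by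
    intro l
    have h1 : (⋃ m ∈ Set.Iic l ∩ N, W ∩ E m).Finite :=
      ((Set.finite_Iic l).inter_of_left N).biUnion fun m hm ↦ hWE m hm.2
    refine h1.subset fun k hk ↦ ?_
    have hkx := hk.1.1.2
    rw [hx] at hkx
    simp only [Set.mem_iUnion] at hkx ⊢
    obtain ⟨m, hm, hkm⟩ := hkx
    exact ⟨m, ⟨hE m hm k hkm ▸ hk.2, hm⟩, hk.1.1.1, hkm⟩
  refine hcinf.image (hinj.mono hcx) ?_
  have h1 : (F c \ F W).Finite := hF.mono_of_subset fun k hk ↦ hk.1.1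
  refine (((Set.Finite.union h1 hW).union (hind c hcx hcl c subset_rfl))).subset ?_
  rintro _ ⟨k, hk, rfl⟩
  have h2 : h k ∉ h '' E n := by
    rintro ⟨l, hl, hlk⟩
    exact hk.2 (hinj (hEx n hn hl) (hcx hk) hlk ▸ hl)
  have h3 : h k ∈ h '' c := ⟨k, hk, rfl⟩
  simp only [Set.mem_union, Set.mem_sdiff]
  tauto

/-- All but finitely many columns are handled correctly by `h`. -/
theorem finite_not_induces_level {F : Set ℕ → Set ℕ} (hF : InducesAuto F) {h r : ℕ → ℕ}
    {Y : Set ℕ} (hind : ∀ c ⊆ Y, FiniteLevels r c → Induces F h c) (hinj : Set.InjOn h Y) :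
    {n | ¬ Induces F h {k ∈ Y | r k = n}}.Finite := by
  by_contra hinf
  set N := {n | ¬ Induces F h {k ∈ Y | r k = n}} with hN
  have hbad : ∀ n ∈ N, ∃ E ⊆ {k ∈ Y | r k = n}, E.Infinite ∧ (F E ∩ h '' E).Finite := by
    intro n hn
    simp only [hN, Induces, Set.mem_ofPred_eq, not_forall] at hn
    obtain ⟨x, hx, hne⟩ := hn
    obtain ⟨E, hE, hE'⟩ := exists_infinite_inter_image_finite hF hne
    exact ⟨E, hE.trans hx, hE'⟩
  choose! E hEs hEinf hEfin using hbad
  have hcover (M : Set ℕ) (hM : M ⊆ N) (hMinf : M.Infinite) :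
      (⋃ n ∈ M, E n) ⊆ Y ∧ {n ∈ M | ¬ h '' E n ⊆ F (⋃ n ∈ M, E n)}.Finite := by
    have hY : (⋃ n ∈ M, E n) ⊆ Y :=
      Set.iUnion₂_subset fun n hn k hk ↦ (hEs n (hM hn) hk).1
    refine ⟨hY, ?_⟩
    refine (finite_image_notMem hF (fun c hc ↦ hind c (hc.trans hY)) (hinj.mono hY)).subset ?_
    rintro n ⟨hn, hns⟩
    obtain ⟨_, ⟨k, hk, rfl⟩, hk'⟩ := Set.not_subset.1 hns
    exact ⟨k, ⟨Set.mem_biUnion hn hk, hk'⟩, (hEs n (hM hn) hk).2⟩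
  obtain ⟨hY, hfin⟩ := hcover N subset_rfl hinf
  have hN₁ := Set.Infinite.sdiff hinf hfin
  set N₁ := N \ {n ∈ N | ¬ h '' E n ⊆ F (⋃ n ∈ N, E n)}
  have hκ : ∀ n ∈ N₁, ∃ m ∈ N, m ≠ n ∧ (F (E m) ∩ h '' E n).Infinite := fun n hn ↦
    exists_ne_infinite_inter hF rfl (fun n hn k hk ↦ (hEs n hn hk).2)
      (fun c hc ↦ hind c (hc.trans hY)) (hinj.mono hY) hn.1 (hEinf n hn.1) (hEfin n hn.1)
      (not_not.1 fun h' ↦ hn.2 ⟨hn.1, h'⟩)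
  choose! κ hκN hκne hκinf using hκ
  obtain ⟨N₂, hN₂, hN₂inf, hfree⟩ := exists_infinite_free hN₁ κ hκne
  obtain ⟨-, hfin₂⟩ := hcover N₂ (fun n hn ↦ (hN₂ hn).1) hN₂inf
  obtain ⟨n, hn, hn'⟩ := (hN₂inf.sdiff hfin₂).nonempty
  have hsub : h '' E n ⊆ F (⋃ n ∈ N₂, E n) := not_not.1 fun h' ↦ hn' ⟨hn, h'⟩
  refine hκinf n (hN₂ hn) ?_
  have hdisj : E (κ n) ∩ ⋃ n ∈ N₂, E n = ∅ := by
    ext k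
    simp only [Set.mem_inter_iff, Set.mem_iUnion, Set.mem_empty_iff_false, iff_false, not_and,
      not_exists]
    intro hk m hm hk'
    have h1 := (hEs _ (hκN n (hN₂ hn)) hk).2
    have h2 := (hEs m (hN₂ hm).1 hk').2
    exact hfree n hn ((h1.symm.trans h2) ▸ hm)
  exact (hF.inter_finite (by simp [hdisj])).subset (Set.inter_subset_inter_right _ hsub)

theorem OmegaCohere.exists_induces_of_levels (hω : OmegaCohere) {F : Set ℕ → Set ℕ}
    (hF : InducesAuto F) {r : ℕ → ℕ} {X : Set ℕ}
    (hlev : ∀ n, ∃ g, Induces F g {k ∈ X | r k ≤ n})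
    (hX : ∀ c ⊆ X, FiniteLevels r c → ∃ g, Induces F g c) : ∃ g, Induces F g X := by
  obtain ⟨h, hh⟩ := hω.exists_induces hF hX
  obtain ⟨n₀, hn₀⟩ := Induces.exists_injOn hF r fun x hx hxl ↦ hh x hx hxl x subset_rfl
  obtain ⟨n₁, hn₁⟩ := (finite_not_induces_level hF (r := r)
    (fun c hc ↦ hh c (hc.trans fun k hk ↦ hk.1)) hn₀).bddAbove
  set n₂ := max n₀ n₁
  have hY : Induces F h {k ∈ X | n₂ < r k} := by
    intro x hx
    by_contra hne
    obtain ⟨E, hE, hEinf, hEfin⟩ := exists_infinite_inter_image_finite hF hne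
    have hgood : ∀ c ⊆ E, Induces F h c → c.Finite := by
      intro c hc hind
      rw [← hF.finite_iff]
      have h1 : (F c \ F E).Finite := hF.mono_of_subset hc
      refine ((Set.Finite.union h1 (hind c subset_rfl)).union hEfin).subset fun k hk ↦ ?_
      have := @Set.image_mono _ _ h _ _ hc k
      simp only [Set.mem_union, Set.mem_sdiff, Set.mem_inter_iff]
      tauto
    refine hEinf (hgood E subset_rfl (hh E (fun k hk ↦ (hx (hE hk)).1) fun n ↦ ?_))
    have hcol (i : ℕ) : {k ∈ E | r k = i}.Finite := by
      by_cases hi : n₂ < i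
      · refine hgood _ (fun k hk ↦ hk.1) (Induces.mono (c := {k ∈ {k ∈ X | n₀ < r k} | r k = i})
          ?_ fun k hk ↦ ?_)
        · by_contra hb
          have := hn₁ hb
          omega
        · have h1 := hx (hE hk.1)
          exact ⟨⟨h1.1, (le_max_left n₀ n₁).trans_lt h1.2⟩, hk.2⟩
      · refine Set.finite_empty.subset fun k hk ↦ hi ?_
        have h1 := hx (hE hk.1)
        exact hk.2 ▸ h1.2
    refine ((Set.finite_Iic n).biUnion fun i _ ↦ hcol i).subset fun k hk ↦ ?_
    simp only [Set.mem_iUnion]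
    exact ⟨r k, hk.2, hk.1, rfl⟩
  obtain ⟨g, hg⟩ := hlev n₂
  obtain ⟨f, hf⟩ := hg.piecewise hF hY
  exact ⟨f, hf.mono fun k hk ↦ by
    rcases le_or_gt (r k) n₂ with h | h
    exacts [Or.inl ⟨hk, h⟩, Or.inr ⟨hk, h⟩]⟩

theorem exists_induces_of_mem_triv {F : Set ℕ → Set ℕ} {c : Set ℕ} (hc : c ∈ Triv F) :
    ∃ h, Induces F h c :=
  let ⟨h, _, hh⟩ := hc
  ⟨h, hh⟩

theorem exists_superset_not_induces (hω : OmegaCohere) {F : Set ℕ → Set ℕ} (hF : InducesAuto F)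
    {a : ℕ → Set ℕ} (haT : ∀ n, a n ∈ Triv F) (hinc : ∀ n m, n ≤ m → (a n \ a m).Finite)
    (hnoub : ¬ ∃ c ∈ Triv F, ∀ n, (a n \ c).Finite)
    {b : Set ℕ} (hb : ∀ n, (b ∩ a n).Finite) :
    ∃ c, (∀ n, (c ∩ a n).Finite) ∧ b ⊆ c ∧ ¬ ∃ g, Induces F g (c \ b) := by
  by_contra! hcon
  refine hnoub ?_
  set r : ℕ → ℕ := fun k ↦ sInf {n | k ∈ a n}
  set X : Set ℕ := (⋃ n, a n) \ b with hX
  have hr : ∀ k ∈ X, k ∈ a (r k) := fun k hk ↦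
    Nat.sInf_mem (s := {n | k ∈ a n}) (Set.mem_iUnion.1 hk.1)
  obtain ⟨g, hg⟩ := hω.exists_induces_of_levels hF (r := r) (X := X) (fun n ↦ by
    obtain ⟨g, hg⟩ := exists_induces_of_mem_triv (haT n)
    refine ⟨g, hg.of_diff_finite hF ?_⟩
    refine ((Set.finite_Iic n).biUnion fun i hi ↦ hinc i n hi).subset fun k hk ↦ ?_
    simp only [Set.mem_iUnion]
    exact ⟨r k, hk.1.2, hr k hk.1.1, hk.2⟩) (fun c hc hcl ↦ by
    obtain ⟨g, hg⟩ := hcon (c ∪ b) (fun n ↦ by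
      refine ((hcl n).union (hb n)).subset ?_
      rintro k ⟨hk | hk, hkn⟩
      · exact Or.inl ⟨hk, Nat.sInf_le hkn⟩
      · exact Or.inr ⟨hk, hkn⟩) Set.subset_union_right
    exact ⟨g, hg.mono fun k hk ↦ ⟨Or.inl hk, (hc hk).2⟩⟩)
  obtain ⟨s, hs, hinj⟩ := hg.exists_finite_injOn hF
  refine ⟨X \ s, ⟨g, hinj, hg.mono Set.sdiff_subset⟩, fun n ↦ ?_⟩
  refine ((hb n).union hs).subset fun k hk ↦ ?_
  have := Set.mem_iUnion_of_mem n hk.1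
  simp [hX] at hk this ⊢
  tauto

theorem exists_almost_upper_bound {ι : Type*} [Countable ι] {a : ℕ → Set ℕ} (f : ι → Set ℕ)
    (hf : ∀ i n, (f i ∩ a n).Finite) :
    ∃ u, (∀ n, (u ∩ a n).Finite) ∧ ∀ i, (f i \ u).Finite := by
  obtain ⟨e, he⟩ := Countable.exists_injective_nat ι
  refine ⟨⋃ i, f i \ ⋃ j ∈ Set.Iic (e i), a j, fun n ↦ ?_, fun i ↦ ?_⟩
  · refine (((Set.finite_Iio n).preimage he.injOn).biUnion fun i _ ↦ hf i n).subset ?_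
    rintro k ⟨hk, hkn⟩
    obtain ⟨i, hki, hk⟩ := Set.mem_iUnion.1 hk
    simp only [Set.mem_iUnion]
    refine ⟨i, show e i < n from lt_of_not_ge fun hi ↦ hk ?_, hki, hkn⟩
    exact Set.mem_biUnion hi hkn
  · refine ((Set.finite_Iic (e i)).biUnion fun j _ ↦ hf i j).subset fun k hk ↦ ?_
    have h1 : k ∈ ⋃ j ∈ Set.Iic (e i), a j := by
      by_contra h
      exact hk.2 (Set.mem_iUnion_of_mem i ⟨hk.1, h⟩)
    simp only [Set.mem_iUnion] at h1 ⊢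
    obtain ⟨j, hj, hkj⟩ := h1
    exact ⟨j, hj, hk.1, hkj⟩

theorem Ordinal.exists_eq_step {α : Type*} (step : Set α → α) :
    ∃ b : Ordinal → α, ∀ ξ, b ξ = step (b '' Set.Iio ξ) := by
  refine ⟨WellFoundedLT.fix fun ξ prev ↦ step {x | ∃ η, ∃ h : η < ξ, prev η h = x}, fun ξ ↦ ?_⟩
  rw [WellFoundedLT.fix_eq]
  congr 1
  ext x
  simp

theorem Ordinal.countable_Iio_of_lt_ord_aleph_one {ξ : Ordinal} (hξ : ξ < (Cardinal.aleph 1).ord) :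
    (Set.Iio ξ).Countable := by
  rw [← Cardinal.le_aleph0_iff_set_countable, Cardinal.mk_Iio_ordinal, Cardinal.lift_le_aleph0]
  exact Cardinal.lt_aleph_one_iff.1 (Cardinal.lt_ord.1 hξ)

theorem Ordinal.not_countable_Iio_ord_aleph_one :
    ¬ (Set.Iio (Cardinal.aleph 1).ord).Countable := by
  rw [← Cardinal.le_aleph0_iff_set_countable, Cardinal.mk_Iio_ordinal, Cardinal.lift_le_aleph0,
    Cardinal.card_ord, not_le]
  exact Cardinal.aleph0_lt_aleph_one

theorem Ordinal.add_one_lt_ord_aleph_one {ξ : Ordinal} (hξ : ξ < (Cardinal.aleph 1).ord) :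
    ξ + 1 < (Cardinal.aleph 1).ord := by
  rw [← Order.succ_eq_add_one]
  exact (Cardinal.isSuccLimit_ord (Cardinal.aleph0_le_aleph 1)).succ_lt hξ

theorem triv_not_ccc_over_fin (hω : OmegaCohere)
    (F : Set ℕ → Set ℕ) (hF : InducesAuto F)
    (hproper : Set.univ ∉ Triv F)
    (hdense : ∀ B : Set ℕ, B.Infinite → ∃ b ⊆ B, b.Infinite ∧ b ∈ Triv F)
    (a : ℕ → Set ℕ) (haT : ∀ n : ℕ, a n ∈ Triv F)
    (hinc : ∀ n m : ℕ, n ≤ m → (a n \ a m).Finite)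
    (hnoub : ¬ ∃ c ∈ Triv F, ∀ n : ℕ, (a n \ c).Finite) :
    (∃ b : Ordinal → Set ℕ,
      (∀ ξ η : Ordinal, ξ < η → η < (Cardinal.aleph 1).ord → (b ξ \ b η).Finite) ∧
      (∀ ξ : Ordinal, ξ < (Cardinal.aleph 1).ord → ∀ n : ℕ, (b ξ ∩ a n).Finite) ∧
      (∀ ξ : Ordinal, ξ < (Cardinal.aleph 1).ord →
        (b (ξ + 1) \ b ξ).Infinite ∧ (b (ξ + 1) \ b ξ) ∉ Triv F)) ∧
    ¬ CccOverFin Set.univ (Triv F) := by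
  have hstep : ∀ S : Set (Set ℕ), (S.Countable ∧ ∀ c ∈ S, ∀ n, (c ∩ a n).Finite) →
      ∃ d : Set ℕ, (∀ n, (d ∩ a n).Finite) ∧ (∀ c ∈ S, (c \ d).Finite) ∧
        ∀ c ∈ S, ¬ ∃ g, Induces F g (d \ c) := by
    rintro S ⟨hS, hSa⟩
    have := hS.to_subtype
    obtain ⟨u, hu, huS⟩ := exists_almost_upper_bound (fun c : S ↦ (c : Set ℕ))
      fun c ↦ hSa c c.2
    obtain ⟨d, hd, hud, hnd⟩ := exists_superset_not_induces hω hF haT hinc hnoub hu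
    refine ⟨d, hd, fun c hc ↦ (huS ⟨c, hc⟩).subset (Set.sdiff_subset_sdiff_right hud), ?_⟩
    rintro c hc ⟨g, hg⟩
    refine hnd ⟨g, hg.of_diff_finite hF ((huS ⟨c, hc⟩).subset fun k hk ↦ ?_)⟩
    simp at hk ⊢
    tauto
  choose! step hstep₁ hstep₂ hstep₃ using hstep
  obtain ⟨b, hb⟩ := Ordinal.exists_eq_step step
  have hperp : ∀ ξ, ξ < (Cardinal.aleph 1).ord → ∀ n, (b ξ ∩ a n).Finite := by
    intro ξ
    induction ξ using WellFoundedLT.induction with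
    | ind ξ ih =>
      intro hξ
      rw [hb ξ]
      refine hstep₁ _ ⟨(Ordinal.countable_Iio_of_lt_ord_aleph_one hξ).image b, ?_⟩
      rintro _ ⟨η, hη, rfl⟩
      exact ih η hη (lt_trans hη hξ)
  have hS : ∀ ξ, ξ < (Cardinal.aleph 1).ord → (b '' Set.Iio ξ).Countable ∧
      ∀ c ∈ b '' Set.Iio ξ, ∀ n, (c ∩ a n).Finite := by
    refine fun ξ hξ ↦ ⟨(Ordinal.countable_Iio_of_lt_ord_aleph_one hξ).image b, ?_⟩
    rintro _ ⟨η, hη, rfl⟩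
    exact hperp η (lt_trans hη hξ)
  have hmono : ∀ ξ η, ξ < η → η < (Cardinal.aleph 1).ord → (b ξ \ b η).Finite := by
    intro ξ η hξη hη
    rw [hb η]
    exact hstep₂ _ (hS η hη) _ ⟨ξ, hξη, rfl⟩
  have hnot : ∀ ξ, ξ < (Cardinal.aleph 1).ord → ¬ ∃ g, Induces F g (b (ξ + 1) \ b ξ) := by
    intro ξ hξ
    have hξ' := Ordinal.add_one_lt_ord_aleph_one hξ
    rw [hb (ξ + 1)]
    exact hstep₃ _ (hS _ hξ') _ ⟨ξ, Set.mem_Iio.2 (Order.lt_add_one_iff.2 le_rfl), rfl⟩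
  have hinf : ∀ ξ, ξ < (Cardinal.aleph 1).ord → (b (ξ + 1) \ b ξ).Infinite := by
    refine fun ξ hξ hfin ↦ hnot ξ hξ ⟨id, fun x hx ↦ ?_⟩
    have hxf := hfin.subset hx
    exact ((hF.finite_iff.2 hxf).union (hxf.image id)).subset
      (Set.union_subset_union Set.sdiff_subset Set.sdiff_subset)
  have hntriv : ∀ ξ, ξ < (Cardinal.aleph 1).ord → b (ξ + 1) \ b ξ ∉ Triv F :=
    fun ξ hξ hT ↦ hnot ξ hξ (exists_induces_of_mem_triv hT)
  refine ⟨⟨b, hmono, hperp, fun ξ hξ ↦ ⟨hinf ξ hξ, hntriv ξ hξ⟩⟩, fun hccc ↦ ?_⟩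
  have hlt : ∀ ξ η, ξ < η → η < (Cardinal.aleph 1).ord →
      ((b (ξ + 1) \ b ξ) ∩ (b (η + 1) \ b η)).Finite := by
    intro ξ η hξη hη
    have h1 : (b (ξ + 1) \ b η).Finite := by
      rcases (Order.add_one_le_iff.2 hξη).eq_or_lt with h | h
      · simp [h]
      · exact hmono _ _ h hη
    exact h1.subset fun k hk ↦ ⟨hk.1.1, hk.2.2⟩
  have had : ∀ ξ η, ξ < (Cardinal.aleph 1).ord → η < (Cardinal.aleph 1).ord → ξ ≠ η →
      ((b (ξ + 1) \ b ξ) ∩ (b (η + 1) \ b η)).Finite := by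
    intro ξ η hξ hη hne
    rcases hne.lt_or_gt with h | h
    · exact hlt ξ η h hη
    · rw [Set.inter_comm]
      exact hlt η ξ h hξ
  have hinj : Set.InjOn (fun ξ ↦ b (ξ + 1) \ b ξ) (Set.Iio (Cardinal.aleph 1).ord) := by
    intro ξ hξ η hη heq
    by_contra hne
    have h1 := had ξ η hξ hη hne
    simp only at heq
    rw [heq, Set.inter_self] at h1
    exact hinf η hη h1
  obtain ⟨_, ⟨ξ, hξ, rfl⟩, hT⟩ := hccc
    ((fun ξ ↦ b (ξ + 1) \ b ξ) '' Set.Iio (Cardinal.aleph 1).ord)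
    (fun h ↦ Ordinal.not_countable_Iio_ord_aleph_one
      (Set.countable_of_injective_of_countable_image hinj h))
    (fun _ _ ↦ Set.subset_univ _)
    ⟨by rintro _ ⟨ξ, hξ, rfl⟩; exact hinf ξ hξ, by
      rintro _ ⟨ξ, hξ, rfl⟩ _ ⟨η, hη, rfl⟩ hne
      exact had ξ η hξ hη fun h ↦ hne (by rw [h])⟩
  exact hntriv ξ hξ hT
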